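/- arXiv:math/0408107 — 3 statements merged into one kernel-verified Lean document; each statement's English description precedes it below -/
import Mathlib

section
/- Every squarefree B-number is a product of B-primes; equivalently, every prime factor of a squarefree B-number is a B-prime. -/
/-- Thue's lemma: modulo a prime `p`, the congruence `x * b ≡ y * a` has a nonzero solution
with `x ^ 2 < p` and `y ^ 2 < p`. -/
theorem exists_small_solution_of_prime {p : ℕ} (hp : p.Prime) (a b : ℤ) :
    ∃ x y : ℤ, (x ≠ 0 ∨ y ≠ 0) ∧ x ^ 2 < p ∧ y ^ 2 < p ∧ (p : ℤ) ∣ x * b - y * a := by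
  have := Fact.mk hp
  set s := Nat.sqrt p with hs
  have hsp : s * s < p := by
    refine lt_of_le_of_ne (Nat.sqrt_le p) fun h => ?_
    exact hp.prime.irreducible.not_isSquare ⟨s, h.symm⟩
  have hps : p < (s + 1) * (s + 1) := Nat.lt_succ_sqrt p
  let f : Fin (s + 1) × Fin (s + 1) → ZMod p := fun u => (u.1 : ℕ) * (b : ZMod p) - (u.2 : ℕ) * a
  obtain ⟨⟨u₁, u₂⟩, ⟨v₁, v₂⟩, huv, hf⟩ := Fintype.exists_ne_map_eq_of_card_lt f (by
    simpa [ZMod.card] using hps)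
  have sq_lt (i j : Fin (s + 1)) : ((i : ℤ) - j) ^ 2 < p := by
    have hi : ((i : ℕ) : ℤ) ≤ s := by exact_mod_cast Nat.lt_succ_iff.mp i.2
    have hj : ((j : ℕ) : ℤ) ≤ s := by exact_mod_cast Nat.lt_succ_iff.mp j.2
    have hsp' : (s : ℤ) * s < p := by exact_mod_cast hsp
    have : ((i : ℤ) - j) ^ 2 ≤ (s : ℤ) ^ 2 := sq_le_sq' (by omega) (by omega)
    linarith [sq (s : ℤ)]
  refine ⟨(u₁ : ℤ) - v₁, (u₂ : ℤ) - v₂, ?_, sq_lt _ _, sq_lt _ _, ?_⟩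
  · by_contra! h
    apply huv
    ext <;> simp only <;> omega
  · rw [← ZMod.intCast_zmod_eq_zero_iff_dvd]
    simp only [f] at hf
    push_cast
    linear_combination hf

/-- A value of `x ^ 2 + x * y + y ^ 2` at integers is also a value at natural numbers. -/
theorem exists_nat_eq_sq_add_mul_add_sq {n : ℕ} {x y : ℤ}
    (h : (n : ℤ) = x ^ 2 + x * y + y ^ 2) : ∃ a b : ℕ, n = a ^ 2 + a * b + b ^ 2 := by
  suffices ∃ a b : ℤ, 0 ≤ a ∧ 0 ≤ b ∧ (n : ℤ) = a ^ 2 + a * b + b ^ 2 by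
    obtain ⟨a, b, ha, hb, hab⟩ := this
    lift a to ℕ using ha
    lift b to ℕ using hb
    exact ⟨a, b, by exact_mod_cast hab⟩
  rcases le_total 0 x with hx | hx <;> rcases le_total 0 y with hy | hy
  · exact ⟨x, y, hx, hy, h⟩
  · rcases le_total 0 (x + y) with hxy | hxy
    · exact ⟨x + y, -y, hxy, by omega, by linear_combination h⟩
    · exact ⟨x, -(x + y), hx, by omega, by linear_combination h⟩
  · rcases le_total 0 (x + y) with hxy | hxy
    · exact ⟨x + y, -x, hxy, by omega, by linear_combination h⟩
    · exact ⟨y, -(x + y), hy, by omega, by linear_combination h⟩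
  · exact ⟨-x, -y, by omega, by omega, by linear_combination h⟩

theorem even_and_even_of_even_sq_add_mul_add_sq {x y : ℤ}
    (h : Even (x ^ 2 + x * y + y ^ 2)) : Even x ∧ Even y := by
  simp only [Int.even_add, Int.even_mul, Int.even_pow] at h
  tauto

/-- A prime dividing `a ^ 2 + a * b + b ^ 2` but not `b` is itself of this form. -/
theorem Nat.Prime.exists_eq_sq_add_mul_add_sq {p : ℕ} (hp : p.Prime) {a b : ℤ}
    (hb : ¬ (p : ℤ) ∣ b) (h : (p : ℤ) ∣ a ^ 2 + a * b + b ^ 2) :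
    ∃ x y : ℕ, p = x ^ 2 + x * y + y ^ 2 := by
  have hp' : _root_.Prime (p : ℤ) := Nat.prime_iff_prime_int.mp hp
  obtain ⟨x, y, hne, hx, hy, hxy⟩ := exists_small_solution_of_prime hp a b
  have hdvd : (p : ℤ) ∣ x ^ 2 + x * y + y ^ 2 := by
    refine (hp'.dvd_or_dvd (a := b ^ 2) ?_).resolve_left fun hb' => hb (hp'.dvd_of_dvd_pow hb')
    have : b ^ 2 * (x ^ 2 + x * y + y ^ 2) =
        (x * b - y * a) * (x * b + y * a + y * b) + y ^ 2 * (a ^ 2 + a * b + b ^ 2) := by ring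
    rw [this]
    exact dvd_add (hxy.mul_right _) (h.mul_left _)
  have hpos : 0 < x ^ 2 + x * y + y ^ 2 := by
    rcases hne with h0 | h0 <;> have := sq_pos_of_ne_zero h0 <;>
      nlinarith [sq_nonneg (x + y), sq_nonneg x, sq_nonneg y]
  have hlt : x ^ 2 + x * y + y ^ 2 < 3 * p := by nlinarith [sq_nonneg (x - y)]
  obtain ⟨k, hk⟩ := hdvd
  have hp0 : (0 : ℤ) < p := by exact_mod_cast hp.pos
  have hk0 : 0 < k := by nlinarith
  have hk3 : k < 3 := by nlinarith
  obtain rfl | rfl : k = 1 ∨ k = 2 := by omega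
  · exact exists_nat_eq_sq_add_mul_add_sq (x := x) (y := y) (by linarith)
  · obtain ⟨⟨u, rfl⟩, ⟨v, rfl⟩⟩ :=
      even_and_even_of_even_sq_add_mul_add_sq (x := x) (y := y) (by simp [hk])
    have h2 : (p : ℤ) = 2 * (u ^ 2 + u * v + v ^ 2) := by linarith
    have hp2 : p = 2 := ((Nat.prime_dvd_prime_iff_eq Nat.prime_two hp).mp
      (by exact_mod_cast Dvd.intro _ h2.symm)).symm
    subst hp2
    have := (even_and_even_of_even_sq_add_mul_add_sq (even_iff_two_dvd.mpr h)).2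
    exact absurd (even_iff_two_dvd.mp this) hb

theorem squarefree_bnum_prime_factor (n : ℕ) (hn : 0 < n)
    (hB : ∃ a b : ℕ, n = a^2 + a*b + b^2) (hsf : Squarefree n)
    (p : ℕ) (hp : p.Prime) (hdvd : p ∣ n) : ∃ a b : ℕ, p = a^2 + a*b + b^2 := by
  obtain ⟨a, b, rfl⟩ := hB
  refine hp.exists_eq_sq_add_mul_add_sq (a := a) (b := b) (fun hb => ?_) (by exact_mod_cast hdvd)
  have hb : p ∣ b := by exact_mod_cast hb
  have ha : p ∣ a := by
    rw [add_assoc, sq b, ← add_mul] at hdvd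
    exact hp.dvd_of_dvd_pow ((Nat.dvd_add_left (hb.mul_left _)).mp hdvd)
  refine hp.not_isUnit (hsf p ?_)
  rw [sq, sq]
  exact dvd_add (dvd_add (mul_dvd_mul ha ha) (mul_dvd_mul ha hb)) (mul_dvd_mul hb hb)
end

section
/- Every prime p with p ≡ 1 (mod 6) can be represented as p = a² + ab + b² with a and b nonnegative integers (i.e., every prime of the form 6k + 1 is a B-prime). -/
/-- **Thue's lemma**: for every residue `w` modulo `n`, the congruence `x = w * y` has a
nonzero solution with `|x|, |y| ≤ √n`. -/
theorem ZMod.exists_intCast_eq_mul_intCast_sq_le (n : ℕ) [NeZero n] (w : ZMod n) :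
    ∃ x y : ℤ, (x ≠ 0 ∨ y ≠ 0) ∧ x ^ 2 ≤ n ∧ y ^ 2 ≤ n ∧ (x : ZMod n) = w * y := by
  set r := Nat.sqrt n
  let s := Finset.range (r + 1) ×ˢ Finset.range (r + 1)
  have hcard : (Finset.univ : Finset (ZMod n)).card < s.card := by
    simp only [s, Finset.card_product, Finset.card_range, Finset.card_univ, ZMod.card]
    exact Nat.lt_succ_sqrt n
  obtain ⟨⟨a, b⟩, hab, ⟨c, d⟩, hcd, hne, heq⟩ :=
    Finset.exists_ne_map_eq_of_card_lt_of_maps_to hcard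
      (f := fun z : ℕ × ℕ => (z.1 : ZMod n) - w * z.2) (fun _ _ => Finset.mem_univ _)
  simp only [s, Finset.mem_product, Finset.mem_range] at hab hcd
  have hr : (r : ℤ) * r ≤ n := mod_cast Nat.sqrt_le n
  have hsq : ∀ i j : ℕ, i < r + 1 → j < r + 1 → ((i : ℤ) - j) ^ 2 ≤ n := by
    intro i j hi hj
    refine le_trans ?_ ((sq (r : ℤ)).trans_le hr)
    exact sq_le_sq' (by omega) (by omega)
  refine ⟨a - c, b - d, ?_, hsq a c hab.1 hcd.1, hsq b d hab.2 hcd.2, ?_⟩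
  · by_contra! h
    exact hne (Prod.ext (by grind) (by grind))
  · push_cast
    linear_combination heq

theorem ZMod.exists_sq_add_self_add_one_eq_zero (p : ℕ) [Fact p.Prime] (h : 3 ∣ p - 1) :
    ∃ w : ZMod p, w ^ 2 + w + 1 = 0 := by
  obtain ⟨u, hu⟩ := exists_prime_orderOf_dvd_card (G := (ZMod p)ˣ) 3
    (by rwa [ZMod.card_units])
  have hu3 : (u : ZMod p) ^ 3 = 1 := by
    rw [← Units.val_pow_eq_pow_val, ← hu, pow_orderOf_eq_one, Units.val_one]
  have hu1 : (u : ZMod p) - 1 ≠ 0 := by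
    intro h1
    rw [sub_eq_zero, Units.val_eq_one] at h1
    simp [h1] at hu
  exact ⟨u, (mul_eq_zero.mp (by linear_combination hu3 :
    ((u : ZMod p) - 1) * ((u : ZMod p) ^ 2 + u + 1) = 0)).resolve_left hu1⟩

theorem Int.exists_nat_sq_add_mul_add_sq_eq (x y : ℤ) :
    ∃ a b : ℕ, (a : ℤ) ^ 2 + a * b + b ^ 2 = x ^ 2 + x * y + y ^ 2 := by
  wlog hxy : |y| ≤ |x| generalizing x y
  · obtain ⟨a, b, hab⟩ := this y x (le_of_not_ge hxy)
    exact ⟨a, b, by rw [hab]; ring⟩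
  wlog hx : 0 ≤ x generalizing x y
  · obtain ⟨a, b, hab⟩ := this (-x) (-y) (by simpa using hxy) (by omega)
    exact ⟨a, b, by rw [hab]; ring⟩
  lift x to ℕ using hx
  rcases le_total 0 y with hy | hy
  · lift y to ℕ using hy
    exact ⟨x, y, rfl⟩
  · have hsum : 0 ≤ (x : ℤ) + y := by
      rw [abs_of_nonpos hy, Nat.abs_cast] at hxy
      omega
    refine ⟨(x + y : ℤ).toNat, (-y).toNat, ?_⟩
    rw [Int.toNat_of_nonneg hsum, Int.toNat_of_nonneg (by omega)]
    ring

theorem Int.four_dvd_of_even_sq_add_mul_add_sq {x y : ℤ} (h : Even (x ^ 2 + x * y + y ^ 2)) :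
    4 ∣ x ^ 2 + x * y + y ^ 2 := by
  have hx : Even x ∧ Even y := by
    simp only [Int.even_add, Int.even_mul, Int.even_pow] at h
    tauto
  obtain ⟨⟨a, rfl⟩, ⟨b, rfl⟩⟩ := hx
  exact ⟨a ^ 2 + a * b + b ^ 2, by ring⟩

theorem one_mod_six_is_bprime (p : ℕ) (hp : p.Prime) (hmod : p % 6 = 1) :
    ∃ a b : ℕ, p = a^2 + a*b + b^2 := by
  have : Fact p.Prime := ⟨hp⟩
  obtain ⟨w, hw⟩ := ZMod.exists_sq_add_self_add_one_eq_zero p (by omega)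
  obtain ⟨x, y, hne, hx, hy, hxy⟩ := ZMod.exists_intCast_eq_mul_intCast_sq_le p w
  have hdvd : (p : ℤ) ∣ x ^ 2 + x * y + y ^ 2 := by
    rw [← ZMod.intCast_zmod_eq_zero_iff_dvd]
    push_cast
    rw [hxy]
    linear_combination (y : ZMod p) ^ 2 * hw
  have hsq : ∀ z : ℤ, z ^ 2 ≠ p := fun z hz =>
    (Nat.prime_iff_prime_int.mp hp).not_isSquare ⟨z, by rw [← hz, sq]⟩
  have hx' := lt_of_le_of_ne hx (hsq x)
  have hy' := lt_of_le_of_ne hy (hsq y)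
  have hpos : 0 < x ^ 2 + x * y + y ^ 2 := by
    rcases hne with h | h
    · nlinarith [sq_nonneg (x + 2 * y), sq_pos_of_ne_zero h]
    · nlinarith [sq_nonneg (2 * x + y), sq_pos_of_ne_zero h]
  have hlt : x ^ 2 + x * y + y ^ 2 < 3 * p := by nlinarith [sq_nonneg (x - y)]
  have hp0 : (0 : ℤ) < p := mod_cast hp.pos
  obtain ⟨k, hk⟩ := hdvd
  have hk0 : 0 < k := by rw [hk] at hpos; exact pos_of_mul_pos_right hpos hp0.le
  have hk3 : k < 3 := by rw [hk] at hlt; nlinarith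
  have hk1 : k = 1 := by
    by_contra hk1
    obtain rfl : k = 2 := by omega
    have h4 := Int.four_dvd_of_even_sq_add_mul_add_sq (hk ▸ even_two.mul_left (p : ℤ))
    omega
  obtain ⟨a, b, hab⟩ := Int.exists_nat_sq_add_mul_add_sq_eq x y
  refine ⟨a, b, ?_⟩
  rw [hk, hk1, mul_one] at hab
  exact_mod_cast hab.symm
end

section
/- If n is a B-number and q is a prime dividing n that is not a B-prime, then q occurs with an even exponent in the prime factorization of n. -/
/-- A value of `x² + xy + y²` at integers is also attained at natural numbers. -/
theorem exists_nat_of_int_sq_add_mul_add_sq (x y : ℤ) :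
    ∃ a b : ℕ, x ^ 2 + x * y + y ^ 2 = (a : ℤ) ^ 2 + a * b + (b : ℤ) ^ 2 := by
  have lift (u v : ℤ) (hu : 0 ≤ u) (hv : 0 ≤ v)
      (h : x ^ 2 + x * y + y ^ 2 = u ^ 2 + u * v + v ^ 2) :
      ∃ a b : ℕ, x ^ 2 + x * y + y ^ 2 = (a : ℤ) ^ 2 + a * b + (b : ℤ) ^ 2 := by
    lift u to ℕ using hu
    lift v to ℕ using hv
    exact ⟨u, v, h⟩
  rcases le_total 0 x with hx | hx <;> rcases le_total 0 y with hy | hy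
  · exact lift x y hx hy rfl
  · rcases le_total 0 (x + y) with h | h
    · exact lift (x + y) (-y) h (by lia) (by ring)
    · exact lift x (-(x + y)) hx (by lia) (by ring)
  · rcases le_total 0 (x + y) with h | h
    · exact lift (-x) (x + y) (by lia) h (by ring)
    · exact lift (-(x + y)) y (by lia) hy (by ring)
  · exact lift (-x) (-y) (by lia) (by lia) (by ring)

/-- Thue's lemma: every residue `t` modulo a prime `q` is a quotient of integers smaller than
`√q` in absolute value. -/
theorem exists_small_int_eq_mul_of_prime {q : ℕ} (hq : q.Prime) (t : ZMod q) :
    ∃ x y : ℤ, (x ≠ 0 ∨ y ≠ 0) ∧ x ^ 2 < q ∧ y ^ 2 < q ∧ (x : ZMod q) = t * y := by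
  have : NeZero q := ⟨hq.ne_zero⟩
  let k := q.sqrt
  have hk : k * k < q := lt_of_le_of_ne (Nat.sqrt_le q) fun h =>
    hq.prime.irreducible.not_isSquare ⟨k, h.symm⟩
  have hcard : Fintype.card (ZMod q) < Fintype.card (Fin (k + 1) × Fin (k + 1)) := by
    simpa [ZMod.card] using Nat.lt_succ_sqrt q
  obtain ⟨⟨a, b⟩, ⟨c, d⟩, hne, heq⟩ := Fintype.exists_ne_map_eq_of_card_lt
    (fun p : Fin (k + 1) × Fin (k + 1) => ((p.1 : ℕ) : ZMod q) - t * ((p.2 : ℕ) : ZMod q)) hcard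
  have small (u v : Fin (k + 1)) : (((u : ℕ) : ℤ) - ((v : ℕ) : ℤ)) ^ 2 < q := by
    have hu := u.is_le
    have hv := v.is_le
    have : ((k : ℕ) : ℤ) * k < q := by exact_mod_cast hk
    refine lt_of_le_of_lt (sq_le_sq' (b := (k : ℤ)) (by lia) (by lia)) (by rwa [sq])
  refine ⟨(a : ℕ) - (c : ℕ), (b : ℕ) - (d : ℕ), ?_, small a c, small b d, ?_⟩
  · by_contra! h
    exact hne (Prod.ext (Fin.ext (by lia)) (Fin.ext (by lia)))
  · push_cast
    linear_combination heq

theorem exists_eq_sq_add_mul_add_sq_of_root {q : ℕ} (hq : q.Prime) (t : ZMod q)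
    (ht : t ^ 2 + t + 1 = 0) : ∃ a b : ℕ, q = a ^ 2 + a * b + b ^ 2 := by
  obtain ⟨x, y, hne, hx, hy, hxy⟩ := exists_small_int_eq_mul_of_prime hq t
  have hdvd : (q : ℤ) ∣ x ^ 2 + x * y + y ^ 2 := by
    have : NeZero q := ⟨hq.ne_zero⟩
    rw [← ZMod.intCast_zmod_eq_zero_iff_dvd]
    push_cast
    rw [hxy]
    linear_combination (y : ZMod q) ^ 2 * ht
  obtain ⟨c, hc⟩ := hdvd
  have hq0 : (0 : ℤ) < q := by exact_mod_cast hq.pos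
  have hpos : 0 < x ^ 2 + x * y + y ^ 2 := by
    rcases hne with h | h <;>
      nlinarith [sq_nonneg (2 * x + y), sq_nonneg (2 * y + x), sq_pos_of_ne_zero h]
  have hc0 : 0 < c := by nlinarith
  have hc3 : c < 3 := by nlinarith [sq_nonneg (x - y)]
  obtain ⟨a, b, hab⟩ := exists_nat_of_int_sq_add_mul_add_sq x y
  obtain rfl | rfl : c = 1 ∨ c = 2 := by lia
  · refine ⟨a, b, ?_⟩
    zify
    linarith
  · exfalso
    have hodd : q ≠ 2 := by
      rintro rfl
      revert ht
      clear hxy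
      revert t
      decide
    have heven : Even (x ^ 2 + x * y + y ^ 2) := ⟨q, by lia⟩
    have hpar : Even x ∧ Even y := by
      simp only [Int.even_add, Int.even_mul, Int.even_pow] at heven
      tauto
    obtain ⟨⟨u, rfl⟩, ⟨v, rfl⟩⟩ := hpar
    have h2 : (q : ℤ) = 2 * (u ^ 2 + u * v + v ^ 2) := by linarith
    have : q % 2 = 0 := by lia
    exact hodd ((hq.even_iff).1 (Nat.even_iff.2 this))

theorem dvd_right_of_dvd_sq_add_mul_add_sq {q a b : ℕ} (hq : q.Prime)
    (hqB : ¬ ∃ a b : ℕ, q = a ^ 2 + a * b + b ^ 2) (h : q ∣ a ^ 2 + a * b + b ^ 2) : q ∣ b := by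
  by_contra hb
  have : Fact q.Prime := ⟨hq⟩
  have hb' : (b : ZMod q) ≠ 0 := mt (ZMod.natCast_eq_zero_iff b q).1 hb
  have h' := (ZMod.natCast_eq_zero_iff _ q).2 h
  push_cast at h'
  refine hqB (exists_eq_sq_add_mul_add_sq_of_root hq ((a : ZMod q) / b) ?_)
  field_simp
  linear_combination h'

theorem even_factorization_sq_add_mul_add_sq {q : ℕ} (hq : q.Prime)
    (hqB : ¬ ∃ a b : ℕ, q = a ^ 2 + a * b + b ^ 2) (n : ℕ) (hn : 0 < n) (a b : ℕ)
    (h : n = a ^ 2 + a * b + b ^ 2) : Even (n.factorization q) := by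
  induction n using Nat.strong_induction_on generalizing a b with
  | _ n ih =>
    by_cases hd : q ∣ n
    · obtain ⟨v, rfl⟩ := dvd_right_of_dvd_sq_add_mul_add_sq hq hqB (h ▸ hd)
      obtain ⟨u, rfl⟩ : q ∣ a := dvd_right_of_dvd_sq_add_mul_add_sq (a := q * v) hq hqB
        (by convert hd using 1; rw [h]; ring)
      have hm : n = q ^ 2 * (u ^ 2 + u * v + v ^ 2) := by rw [h]; ring
      have hm0 : 0 < u ^ 2 + u * v + v ^ 2 := Nat.pos_of_mul_pos_left (hm ▸ hn)
      have hlt : u ^ 2 + u * v + v ^ 2 < n := by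
        rw [hm]
        exact lt_mul_of_one_lt_left hm0 (Nat.one_lt_pow two_ne_zero hq.one_lt)
      have := ih _ hlt hm0 u v rfl
      rw [hm, Nat.factorization_mul (pow_ne_zero 2 hq.ne_zero) hm0.ne']
      simpa [hq.factorization_self] using even_two.add this
    · simp [Nat.factorization_eq_zero_of_not_dvd hd]

theorem nonbprime_even_exponent (n : ℕ) (hn : 0 < n)
    (hB : ∃ a b : ℕ, n = a^2 + a*b + b^2)
    (q : ℕ) (hq : q.Prime) (hdvd : q ∣ n)
    (hqB : ¬ ∃ a b : ℕ, q = a^2 + a*b + b^2) :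
    Even (n.factorization q) := by
  obtain ⟨a, b, h⟩ := hB
  exact even_factorization_sq_add_mul_add_sq hq hqB n hn a b h
end
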